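/- Every morphism u of Ω_n^epi of degree 2 admits exactly two factorizations u = v_1 ∘ w_1 = v_2 ∘ w_2 as composites of two morphisms of degree 1. -/

import Mathlib

open CategoryTheory

/-- An object of the category `Ω_n^epi` of pruned `n`-level trees: a sequence of
monotone surjections `T_0 → T_1 → ⋯ → T_n` between the finite ordered sets
`T_i = Fin (t i)`, with `T_n` (and all higher levels) a one-point set. -/
structure PTree (n : ℕ) where
  t : ℕ → ℕ
  map : ∀ i : ℕ, Fin (t i) → Fin (t (i+1))
  mono : ∀ i, Monotone (map i)
  surjmap : ∀ i, Function.Surjective (map i)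
  top : ∀ i, n ≤ i → t i = 1

/-- A morphism of pruned trees: a family of surjections commuting with the
structure maps, order-preserving on every fiber of the structure maps. -/
structure PTreeHom {n : ℕ} (τ σ : PTree n) where
  app : ∀ i, Fin (τ.t i) → Fin (σ.t i)
  surj : ∀ i, Function.Surjective (app i)
  comm : ∀ i x, app (i+1) (τ.map i x) = σ.map i (app i x)
  fiberMono : ∀ i x y, τ.map i x = τ.map i y → x ≤ y → app i x ≤ app i y

theorem PTreeHom.ext' {n : ℕ} {τ σ : PTree n} {f g : PTreeHom τ σ}
    (h : f.app = g.app) : f = g := by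
  cases f; cases g; cases h; rfl

instance (n : ℕ) : Category (PTree n) where
  Hom := PTreeHom
  id τ := ⟨fun _ => _root_.id, fun _ => Function.surjective_id, fun _ _ => rfl,
    fun _ _ _ _ h => h⟩
  comp f g :=
    ⟨fun i => g.app i ∘ f.app i,
     fun i => (g.surj i).comp (f.surj i),
     fun i x => by simp only [Function.comp_apply, f.comm, g.comm],
     fun i x y hxy hle =>
       g.fiberMono i _ _ (by rw [← f.comm, ← f.comm, hxy]) (f.fiberMono i x y hxy hle)⟩
  id_comp _ := PTreeHom.ext' rfl
  comp_id _ := PTreeHom.ext' rfl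
  assoc _ _ _ := PTreeHom.ext' rfl

/-- The degree of a pruned tree: the number of vertices of levels `0,…,n-1`. -/
def PTree.deg {n : ℕ} (τ : PTree n) : ℕ := ∑ i ∈ Finset.range n, τ.t i

/-- The degree of a morphism `u : τ ⟶ σ`: `deg τ - deg σ`. -/
def homDeg {n : ℕ} {τ σ : PTree n} (_ : τ ⟶ σ) : ℤ :=
  (τ.deg : ℤ) - (σ.deg : ℤ)

/-- A morphism (with possibly different source and target) is an identity. -/
def IsIdentityHom {n : ℕ} {τ σ : PTree n} (u : τ ⟶ σ) : Prop :=
  ∃ h : τ = σ, u = eqToHom h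

/-- The equivalence relation identifying only the two elements `a` and `b`. -/
def PairRel {V : Type*} (a b x y : V) : Prop :=
  x = y ∨ (x = a ∧ y = b) ∨ (x = b ∧ y = a)

section Kernels

variable {A B : Type*} {f : A → B}

theorem surjective_restrict_ne (hf : Function.Surjective f) {a b : A} (hab : a ≠ b)
    (h : f a = f b) : Function.Surjective (fun x : {x : A // x ≠ b} => f x.1) := by
  intro y
  obtain ⟨x, rfl⟩ := hf y
  by_cases hx : x = b
  · exact ⟨⟨a, hab⟩, by simp [h, hx]⟩
  · exact ⟨⟨x, hx⟩, rfl⟩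

variable [Fintype A] [Fintype B]

theorem card_eq_add_one_iff_exists_pairRel (hf : Function.Surjective f) :
    Fintype.card A = Fintype.card B + 1 ↔
      ∃ a b, a ≠ b ∧ ∀ x y, f x = f y ↔ PairRel a b x y := by
  classical
  constructor
  · intro h
    obtain ⟨a, b, hab, hfab⟩ := Fintype.exists_ne_map_eq_of_card_lt f (by omega)
    have hs := surjective_restrict_ne hf hab hfab
    have hc : Fintype.card {x : A // x ≠ b} = Fintype.card B := by
      rw [Fintype.card_subtype_compl, Fintype.card_subtype_eq]; omega
    have hi : Function.Injective (fun x : {x : A // x ≠ b} => f x.1) :=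
      ((Fintype.bijective_iff_surjective_and_card _).2 ⟨hs, hc⟩).1
    have hi' : ∀ x y, x ≠ b → y ≠ b → f x = f y → x = y := fun x y hx hy hxy =>
      congrArg Subtype.val (@hi ⟨x, hx⟩ ⟨y, hy⟩ hxy)
    refine ⟨a, b, hab, fun x y => ?_⟩
    unfold PairRel
    by_cases hx : x = b <;> by_cases hy : y = b <;> grind
  · rintro ⟨a, b, hab, h⟩
    have hfab : f a = f b := (h a b).2 (Or.inr (Or.inl ⟨rfl, rfl⟩))
    have hs := surjective_restrict_ne hf hab hfab
    have hi : Function.Injective (fun x : {x : A // x ≠ b} => f x.1) := by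
      rintro ⟨x, hx⟩ ⟨y, hy⟩ hxy
      have := (h x y).1 hxy
      unfold PairRel at this
      grind
    have hc := Fintype.card_of_bijective ⟨hi, hs⟩
    rw [Fintype.card_subtype_compl, Fintype.card_subtype_eq] at hc
    have : 0 < Fintype.card A := Fintype.card_pos_iff.2 ⟨a⟩
    omega

/-- A surjection between finite types dropping the cardinality by two identifies either three
elements or two disjoint pairs of elements. -/
theorem exists_ker_of_card_eq_add_two (hf : Function.Surjective f)
    (h : Fintype.card A = Fintype.card B + 2) :
    (∃ a b c, a ≠ b ∧ b ≠ c ∧ a ≠ c ∧ ∀ x y, f x = f y ↔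
      x = y ∨ ((x = a ∨ x = b ∨ x = c) ∧ (y = a ∨ y = b ∨ y = c))) ∨
    (∃ a b c d, a ≠ b ∧ c ≠ d ∧ a ≠ c ∧ a ≠ d ∧ b ≠ c ∧ b ≠ d ∧ ∀ x y, f x = f y ↔
      PairRel a b x y ∨ PairRel c d x y) := by
  classical
  obtain ⟨a, b, hab, hfab⟩ := Fintype.exists_ne_map_eq_of_card_lt f (by omega)
  have hs := surjective_restrict_ne hf hab hfab
  have hc : Fintype.card {x : A // x ≠ b} = Fintype.card B + 1 := by
    rw [Fintype.card_subtype_compl, Fintype.card_subtype_eq]; omega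
  obtain ⟨⟨c, hcb⟩, ⟨d, hdb⟩, hcd, hk⟩ := (card_eq_add_one_iff_exists_pairRel hs).1 hc
  have hk' : ∀ x y, x ≠ b → y ≠ b → (f x = f y ↔ PairRel c d x y) := by
    intro x y hx hy
    have := hk ⟨x, hx⟩ ⟨y, hy⟩
    simpa [PairRel] using this
  have hcd' : c ≠ d := fun e => hcd (Subtype.ext e)
  simp only [PairRel] at hk' ⊢
  by_cases hac : a = c
  · refine Or.inl ⟨a, b, d, hab, hdb.symm, by grind, fun x y => ?_⟩
    have := hk' x y
    have := hk' a y
    have := hk' x a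
    by_cases hx : x = b <;> by_cases hy : y = b <;> grind
  by_cases had : a = d
  · refine Or.inl ⟨a, b, c, hab, hcb.symm, by grind, fun x y => ?_⟩
    have := hk' x y
    have := hk' a y
    have := hk' x a
    by_cases hx : x = b <;> by_cases hy : y = b <;> grind
  · refine Or.inr ⟨a, b, c, d, hab, hcd', hac, had, hcb.symm, hdb.symm, fun x y => ?_⟩
    have := hk' x y
    have := hk' a y
    have := hk' x a
    by_cases hx : x = b <;> by_cases hy : y = b <;> grind

end Kernels

section TieBreak

variable {V V' : Type*} [PartialOrder V]

/-- The data which, for a map `U` of forests, determine a factorization of `U` through a map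
identifying a single pair of vertices: a total preorder `T` on each fiber of `U`,
compatible with the parent map `P` and with the order on siblings. -/
structure IsTieBreak (P : V → V) (U : V → V') (T : V → V → Prop) : Prop where
  ker : ∀ {x y}, T x y → U x = U y
  total : ∀ {x y}, U x = U y → T x y ∨ T y x
  trans : ∀ {x y z}, T x y → T y z → T x z
  parent : ∀ {x y}, T x y → T (P x) (P y)
  sibling : ∀ {x y}, P x = P y → U x = U y → x ≤ y → T x y
  merge : ∃ a b, a ≠ b ∧ ∀ x y, (T x y ∧ T y x) ↔ PairRel a b x y

variable {P : V → V} {U : V → V'} {T : V → V → Prop}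

theorem IsTieBreak.refl (h : IsTieBreak P U T) (x : V) : T x x :=
  (h.total rfl).elim id id

theorem card_tieBreak_eq_two {T₁ T₂ : V → V → Prop} (h₁ : IsTieBreak P U T₁)
    (h₂ : IsTieBreak P U T₂) (hne : T₁ ≠ T₂)
    (h : ∀ T, IsTieBreak P U T → (∀ x y, T x y ↔ T₁ x y) ∨ (∀ x y, T x y ↔ T₂ x y)) :
    Nat.card {T // IsTieBreak P U T} = 2 := by
  refine Nat.card_eq_two_iff.2 ⟨⟨T₁, h₁⟩, ⟨T₂, h₂⟩, by simpa using hne, ?_⟩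
  refine Set.eq_univ_of_forall ?_
  rintro ⟨T, hT⟩
  rcases h T hT with h | h
  · exact Or.inl (Subtype.ext (funext₂ fun x y => propext (h x y)))
  · exact Or.inr (Subtype.ext (funext₂ fun x y => propext (h x y)))

theorem card_tieBreak_of_triple
    {a b c : V} (hab : a < b) (hbc : b < c) (hPab : P a = P b) (hPbc : P b = P c)
    (hK : ∀ x y, U x = U y ↔
      x = y ∨ ((x = a ∨ x = b ∨ x = c) ∧ (y = a ∨ y = b ∨ y = c))) :
    Nat.card {T // IsTieBreak P U T} = 2 := by
  have hac := hab.trans hbc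
  have n1 := hab.not_ge
  have n2 := hbc.not_ge
  have n3 := hac.not_ge
  have e1 := hab.ne
  have e2 := hbc.ne
  have e3 := hac.ne
  refine card_tieBreak_eq_two
    (T₁ := fun x y => x = y ∨ (x = a ∧ y = b) ∨ (x = a ∧ y = c) ∨ (x = b ∧ y = c) ∨
      (x = b ∧ y = a))
    (T₂ := fun x y => x = y ∨ (x = a ∧ y = b) ∨ (x = a ∧ y = c) ∨ (x = b ∧ y = c) ∨
      (x = c ∧ y = b)) ?_ ?_ ?_ ?_
  · constructor
    · grind
    · grind
    · clear hK; grind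
    · clear hK; grind
    · grind
    · exact ⟨a, b, e1, by unfold PairRel; grind⟩
  · constructor
    · grind
    · grind
    · clear hK; grind
    · clear hK; grind
    · grind
    · exact ⟨b, c, e2, by unfold PairRel; grind⟩
  · intro h
    have := congrFun₂ h b a
    grind
  · intro T hT
    obtain ⟨p, q, hpq, hm⟩ := hT.merge
    unfold PairRel at hm
    have tab : T a b := hT.sibling hPab (by grind) hab.le
    have tbc : T b c := hT.sibling hPbc (by grind) hbc.le
    have tac : T a c := hT.trans tab tbc
    have hr := hT.refl
    have hk := @IsTieBreak.ker _ _ _ _ _ _ hT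
    have m1 := hm a b
    have m2 := hm b c
    have m3 := hm a c
    have t1 : T c a → T c b := fun h => hT.trans h tab
    have t2 : T c a → T b a := fun h => hT.trans tbc h
    have m4 := (hm p q).2 (by grind)
    have m5 := hk m4.1
    by_cases hba : T b a
    · left
      intro x y
      grind
    · right
      intro x y
      grind

theorem card_tieBreak_of_siblings {a b c d : V} (hab : a < b) (hcd : c < d)
    (hPab : P a = P b) (hPcd : P c = P d)
    (hac : a ≠ c) (had : a ≠ d) (hbc : b ≠ c) (hbd : b ≠ d)
    (hK : ∀ x y, U x = U y ↔ PairRel a b x y ∨ PairRel c d x y) :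
    Nat.card {T // IsTieBreak P U T} = 2 := by
  unfold PairRel at hK
  have n1 := hab.not_ge
  have n2 := hcd.not_ge
  have e1 := hab.ne
  have e2 := hcd.ne
  refine card_tieBreak_eq_two
    (T₁ := fun x y => x = y ∨ (x = a ∧ y = b) ∨ (x = c ∧ y = d) ∨ (x = b ∧ y = a))
    (T₂ := fun x y => x = y ∨ (x = a ∧ y = b) ∨ (x = c ∧ y = d) ∨ (x = d ∧ y = c)) ?_ ?_ ?_ ?_
  · constructor
    · grind
    · grind
    · clear hK; grind
    · clear hK; grind
    · grind
    · exact ⟨a, b, e1, by unfold PairRel; grind⟩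
  · constructor
    · grind
    · grind
    · clear hK; grind
    · clear hK; grind
    · grind
    · exact ⟨c, d, e2, by unfold PairRel; grind⟩
  · intro h
    have := congrFun₂ h b a
    grind
  · intro T hT
    obtain ⟨p, q, hpq, hm⟩ := hT.merge
    unfold PairRel at hm
    have tab : T a b := hT.sibling hPab (by grind) hab.le
    have tcd : T c d := hT.sibling hPcd (by grind) hcd.le
    have hr := hT.refl
    have hk := @IsTieBreak.ker _ _ _ _ _ _ hT
    have m1 := hm a b
    have m2 := hm c d
    have m4 := (hm p q).2 (by grind)
    have m5 := hk m4.1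
    by_cases hba : T b a
    · left
      intro x y
      grind
    · right
      intro x y
      grind

theorem card_tieBreak_of_parents {a b c d : V} (hab : a ≠ b) (hcd : c < d)
    (hPa : P a = c) (hPb : P b = d) (hPcd : P c = P d)
    (hac : a ≠ c) (had : a ≠ d) (hbc : b ≠ c) (hbd : b ≠ d)
    (hK : ∀ x y, U x = U y ↔ PairRel a b x y ∨ PairRel c d x y) :
    Nat.card {T // IsTieBreak P U T} = 2 := by
  unfold PairRel at hK
  have n2 := hcd.not_ge
  have e2 := hcd.ne
  refine card_tieBreak_eq_two
    (T₁ := fun x y => x = y ∨ (x = c ∧ y = d) ∨ (x = d ∧ y = c) ∨ (x = a ∧ y = b))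
    (T₂ := fun x y => x = y ∨ (x = c ∧ y = d) ∨ (x = d ∧ y = c) ∨ (x = b ∧ y = a)) ?_ ?_ ?_ ?_
  · constructor
    · grind
    · grind
    · clear hK; grind
    · clear hK; grind
    · grind
    · exact ⟨c, d, e2, by unfold PairRel; grind⟩
  · constructor
    · grind
    · grind
    · clear hK; grind
    · clear hK; grind
    · grind
    · exact ⟨c, d, e2, by unfold PairRel; grind⟩
  · intro h
    have := congrFun₂ h b a
    grind
  · intro T hT
    obtain ⟨p, q, hpq, hm⟩ := hT.merge
    unfold PairRel at hm
    have tcd : T c d := hT.sibling hPcd (by grind) hcd.le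
    have hr := hT.refl
    have hk := @IsTieBreak.ker _ _ _ _ _ _ hT
    have tab : T a b ∨ T b a := hT.total (by grind)
    have tba : T b a → T d c := fun h => by simpa [hPa, hPb] using hT.parent h
    have m1 := hm a b
    have m2 := hm c d
    have m4 := (hm p q).2 (by grind)
    have m5 := hk m4.1
    by_cases hba : T a b
    · left
      intro x y
      grind
    · right
      intro x y
      grind

theorem card_tieBreak (hU : ∀ x y, U x = U y → U (P x) = U (P y))
    (hP : ∀ x y, P x = P y → x ≤ y ∨ y ≤ x)
    (l : V → ℕ) (hl : ∀ x, l (P x) = l x + 1) (hlU : ∀ x y, U x = U y → l x = l y)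
    (hK : (∃ a b c, a ≠ b ∧ b ≠ c ∧ a ≠ c ∧ ∀ x y, U x = U y ↔
      x = y ∨ ((x = a ∨ x = b ∨ x = c) ∧ (y = a ∨ y = b ∨ y = c))) ∨
      (∃ a b c d, a ≠ b ∧ c ≠ d ∧ a ≠ c ∧ a ≠ d ∧ b ≠ c ∧ b ≠ d ∧ ∀ x y, U x = U y ↔
        PairRel a b x y ∨ PairRel c d x y)) :
    Nat.card {T // IsTieBreak P U T} = 2 := by
  have hlt : ∀ x y, x ≠ y → P x = P y → x < y ∨ y < x := fun x y hne h =>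
    (hP x y h).imp (fun h => lt_of_le_of_ne h hne) (fun h => lt_of_le_of_ne h hne.symm)
  rcases hK with ⟨a, b, c, hab, hbc, hac, hK⟩ | ⟨a, b, c, d, hab, hcd, hac, had, hbc, hbd, hK⟩
  · have lab := hlU a b ((hK a b).2 (by grind))
    have lac := hlU a c ((hK a c).2 (by grind))
    have hla := hl a
    have hlb := hl b
    have hlc := hl c
    have hPab : P a = P b := by
      have := (hK _ _).1 (hU a b ((hK a b).2 (by grind)))
      grind
    have hPbc : P b = P c := by
      have := (hK _ _).1 (hU b c ((hK b c).2 (by grind)))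
      grind
    have key : ∃ a' b' c', a' < b' ∧ b' < c' ∧ P a' = P b' ∧ P b' = P c' ∧
        ∀ x, (x = a ∨ x = b ∨ x = c) ↔ (x = a' ∨ x = b' ∨ x = c') := by
      rcases hlt a b hab hPab with h1 | h1 <;> rcases hlt b c hbc hPbc with h2 | h2 <;>
        rcases hlt a c hac (hPab.trans hPbc) with h3 | h3
      · exact ⟨a, b, c, h1, h2, by grind⟩
      · exact absurd (h1.trans h2) h3.not_gt
      · exact ⟨a, c, b, h3, h2, by grind⟩
      · exact ⟨c, a, b, h3, h1, by grind⟩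
      · exact ⟨b, a, c, h1, h3, by grind⟩
      · exact ⟨b, c, a, h2, h3, by grind⟩
      · exact absurd (h2.trans h1) h3.not_gt
      · exact ⟨c, b, a, h2, h1, by grind⟩
    obtain ⟨a', b', c', h1, h2, h3, h4, h5⟩ := key
    simp only [h5] at hK
    exact card_tieBreak_of_triple h1 h2 h3 h4 hK
  · have swap : ∀ p q x y : V, PairRel p q x y ↔ PairRel q p x y := by
      unfold PairRel; grind
    have lab := hlU a b ((hK a b).2 (by unfold PairRel; grind))
    have lcd := hlU c d ((hK c d).2 (by unfold PairRel; grind))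
    have hla := hl a
    have hlb := hl b
    have hlc := hl c
    have hld := hl d
    have hPab : P a = P b ∨ (P a = c ∧ P b = d) ∨ (P a = d ∧ P b = c) := by
      have := (hK _ _).1 (hU a b ((hK a b).2 (by unfold PairRel; grind)))
      unfold PairRel at this
      grind
    have hPcd : P c = P d ∨ (P c = a ∧ P d = b) ∨ (P c = b ∧ P d = a) := by
      have := (hK _ _).1 (hU c d ((hK c d).2 (by unfold PairRel; grind)))
      unfold PairRel at this
      grind
    have nested : ∀ a b c d : V, a ≠ b → c ≠ d → P a = c → P b = d → P c = P d →
        a ≠ c → a ≠ d → b ≠ c → b ≠ d →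
        (∀ x y, U x = U y ↔ PairRel a b x y ∨ PairRel c d x y) →
        Nat.card {T // IsTieBreak P U T} = 2 := by
      intro a b c d hab hcd h1 h2 h3 hac had hbc hbd hK
      rcases hlt c d hcd h3 with h | h
      · exact card_tieBreak_of_parents hab h h1 h2 h3 hac had hbc hbd hK
      · exact card_tieBreak_of_parents hab.symm h h2 h1 h3.symm hbd hbc had hac
          (fun x y => by rw [hK, swap a b, swap c d])
    rcases hPab with hPab | ⟨h1, h2⟩ | ⟨h1, h2⟩
    · rcases hPcd with hPcd | ⟨h1, h2⟩ | ⟨h1, h2⟩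
      · rcases hlt a b hab hPab with h1 | h1 <;> rcases hlt c d hcd hPcd with h2 | h2
        · exact card_tieBreak_of_siblings h1 h2 hPab hPcd hac had hbc hbd hK
        · exact card_tieBreak_of_siblings h1 h2 hPab hPcd.symm had hac hbd hbc
            (fun x y => by rw [hK, swap c d])
        · exact card_tieBreak_of_siblings h1 h2 hPab.symm hPcd hbc hbd hac had
            (fun x y => by rw [hK, swap a b])
        · exact card_tieBreak_of_siblings h1 h2 hPab.symm hPcd.symm hbd hbc had hac
            (fun x y => by rw [hK, swap a b, swap c d])
      · exact nested c d a b hcd hab h1 h2 hPab hac.symm hbc.symm had.symm hbd.symm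
          (fun x y => by rw [hK, or_comm])
      · exact nested d c a b hcd.symm hab h2 h1 hPab had.symm hbd.symm hac.symm hbc.symm
          (fun x y => by rw [hK, or_comm, swap c d])
    · exact nested a b c d hab hcd h1 h2 (by grind) hac had hbc hbd hK
    · exact nested b a c d hab.symm hcd h2 h1 (by grind) hbc hbd hac had
        (fun x y => by rw [hK, swap a b])

end TieBreak

namespace PTree

variable {n : ℕ}

/-- The vertices of a pruned tree, ordered levelwise. -/
abbrev Vertex (τ : PTree n) : Type := Σ i, Fin (τ.t i)

/-- The parent of a vertex. -/
def parent (τ : PTree n) (x : τ.Vertex) : τ.Vertex := ⟨x.1 + 1, τ.map x.1 x.2⟩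

theorem parent_mono (τ : PTree n) {x y : τ.Vertex} (h : x ≤ y) : τ.parent x ≤ τ.parent y := by
  obtain ⟨i, a, b, h⟩ := h
  exact Sigma.LE.fiber _ _ _ (τ.mono i h)

theorem le_or_le (τ : PTree n) {x y : τ.Vertex} (h : x.1 = y.1) : x ≤ y ∨ y ≤ x := by
  obtain ⟨i, a⟩ := x
  obtain ⟨j, b⟩ := y
  obtain rfl : i = j := h
  simpa using le_total a b

theorem level_eq_of_le (τ : PTree n) {x y : τ.Vertex} (h : x ≤ y) : x.1 = y.1 := by
  obtain ⟨i, a, b, h⟩ := h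
  rfl

theorem eq_of_le_level (τ : PTree n) {x y : τ.Vertex} (h : x.1 = y.1) (hn : n ≤ x.1) :
    x = y := by
  obtain ⟨i, a⟩ := x
  obtain ⟨j, b⟩ := y
  obtain rfl : i = j := h
  have : Subsingleton (Fin (τ.t i)) := by rw [τ.top i hn]; infer_instance
  rw [Subsingleton.elim a b]

end PTree

namespace PTreeHom

variable {n : ℕ} {τ θ σ : PTree n}

/-- The map induced by a morphism of trees on vertices. -/
def vertexMap (u : PTreeHom τ σ) (x : τ.Vertex) : σ.Vertex := ⟨x.1, u.app x.1 x.2⟩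

theorem level_eq {u : PTreeHom τ σ} {x y : τ.Vertex} (h : u.vertexMap x = u.vertexMap y) :
    x.1 = y.1 := (congrArg Sigma.fst h :)

theorem vertexMap_parent (u : PTreeHom τ σ) (x : τ.Vertex) :
    u.vertexMap (τ.parent x) = σ.parent (u.vertexMap x) := by
  simp [vertexMap, PTree.parent, u.comm]

theorem vertexMap_le (u : PTreeHom τ σ) {x y : τ.Vertex} (hp : τ.parent x = τ.parent y)
    (h : x ≤ y) : u.vertexMap x ≤ u.vertexMap y := by
  obtain ⟨i, a, b, h⟩ := h
  refine Sigma.LE.fiber _ _ _ (u.fiberMono i a b ?_ h)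
  simpa [PTree.parent] using hp

/-- The restriction of `vertexMap` to the levels which contribute to the degree. -/
def levelMap (u : PTreeHom τ σ) (x : Σ i : Fin n, Fin (τ.t i)) : Σ i : Fin n, Fin (σ.t i) :=
  ⟨x.1, u.app x.1 x.2⟩

theorem levelMap_surjective (u : PTreeHom τ σ) : Function.Surjective u.levelMap := by
  rintro ⟨i, a⟩
  obtain ⟨b, rfl⟩ := u.surj i a
  exact ⟨⟨i, b⟩, rfl⟩

theorem _root_.PTree.card_levels (τ : PTree n) :
    Fintype.card (Σ i : Fin n, Fin (τ.t i)) = τ.deg := by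
  simp [PTree.deg, Finset.sum_range]

/-- The inclusion of the vertices contributing to the degree into all vertices. -/
def _root_.PTree.levelIncl (τ : PTree n) (x : Σ i : Fin n, Fin (τ.t i)) : τ.Vertex := ⟨x.1, x.2⟩

theorem _root_.PTree.levelIncl_injective (τ : PTree n) : Function.Injective τ.levelIncl := by
  rintro ⟨i, a⟩ ⟨j, b⟩ h
  simp only [PTree.levelIncl, Sigma.mk.injEq] at h
  obtain ⟨h1, h2⟩ := h
  obtain rfl := Fin.ext h1
  simpa using h2

theorem _root_.PTree.exists_levelIncl (τ : PTree n) {x : τ.Vertex} (h : x.1 < n) :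
    ∃ a, τ.levelIncl a = x := ⟨⟨⟨x.1, h⟩, x.2⟩, rfl⟩

theorem vertexMap_levelIncl (u : PTreeHom τ σ) (x y : Σ i : Fin n, Fin (τ.t i)) :
    u.vertexMap (τ.levelIncl x) = u.vertexMap (τ.levelIncl y) ↔ u.levelMap x = u.levelMap y :=
  σ.levelIncl_injective.eq_iff (a := u.levelMap x) (b := u.levelMap y)

theorem level_lt_of_ne {u : PTreeHom τ σ} {x y : τ.Vertex} (h : u.vertexMap x = u.vertexMap y)
    (hne : x ≠ y) : x.1 < n := by
  by_contra hn
  exact hne (τ.eq_of_le_level (level_eq h) (not_lt.1 hn))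

theorem vertexMap_eq_iff (u : PTreeHom τ σ) {r : τ.Vertex → τ.Vertex → Prop}
    (hr : ∀ x, r x x) (hrn : ∀ x y, r x y → x = y ∨ (x.1 < n ∧ y.1 < n))
    (h : ∀ x y, u.levelMap x = u.levelMap y ↔ r (τ.levelIncl x) (τ.levelIncl y))
    (x y : τ.Vertex) : u.vertexMap x = u.vertexMap y ↔ r x y := by
  by_cases hxy : x = y
  · subst hxy
    simp [hr]
  · constructor
    · intro hu
      obtain ⟨a, rfl⟩ := τ.exists_levelIncl (level_lt_of_ne hu hxy)
      obtain ⟨b, rfl⟩ := τ.exists_levelIncl (level_lt_of_ne hu.symm (Ne.symm hxy))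
      rwa [← h, ← vertexMap_levelIncl]
    · intro hu
      obtain ⟨hx, hy⟩ := (hrn x y hu).resolve_left hxy
      obtain ⟨a, rfl⟩ := τ.exists_levelIncl hx
      obtain ⟨b, rfl⟩ := τ.exists_levelIncl hy
      rwa [vertexMap_levelIncl, h]

theorem deg_eq_add_one_iff (u : PTreeHom τ σ) :
    τ.deg = σ.deg + 1 ↔
      ∃ a b, a ≠ b ∧ ∀ x y, u.vertexMap x = u.vertexMap y ↔ PairRel a b x y := by
  rw [← τ.card_levels, ← σ.card_levels,
    card_eq_add_one_iff_exists_pairRel u.levelMap_surjective]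
  constructor
  · rintro ⟨a, b, hab, h⟩
    refine ⟨τ.levelIncl a, τ.levelIncl b, τ.levelIncl_injective.ne hab,
      u.vertexMap_eq_iff (fun x => Or.inl rfl) ?_ fun x y => ?_⟩
    · rintro x y (rfl | ⟨rfl, rfl⟩ | ⟨rfl, rfl⟩)
      · exact Or.inl rfl
      · exact Or.inr ⟨a.1.2, b.1.2⟩
      · exact Or.inr ⟨b.1.2, a.1.2⟩
    · simp [h, PairRel, τ.levelIncl_injective.eq_iff]
  · rintro ⟨a, b, hab, h⟩
    have huab := (h a b).2 (Or.inr (Or.inl ⟨rfl, rfl⟩))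
    obtain ⟨a, rfl⟩ := τ.exists_levelIncl (level_lt_of_ne huab hab)
    obtain ⟨b, rfl⟩ := τ.exists_levelIncl (level_lt_of_ne huab.symm (Ne.symm hab))
    refine ⟨a, b, fun e => hab (congrArg _ e), fun x y => ?_⟩
    rw [← vertexMap_levelIncl, h]
    simp [PairRel, τ.levelIncl_injective.eq_iff]

theorem exists_ker_of_deg_eq_add_two (u : PTreeHom τ σ) (hd : τ.deg = σ.deg + 2) :
    (∃ a b c, a ≠ b ∧ b ≠ c ∧ a ≠ c ∧ ∀ x y, u.vertexMap x = u.vertexMap y ↔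
      x = y ∨ ((x = a ∨ x = b ∨ x = c) ∧ (y = a ∨ y = b ∨ y = c))) ∨
    (∃ a b c d, a ≠ b ∧ c ≠ d ∧ a ≠ c ∧ a ≠ d ∧ b ≠ c ∧ b ≠ d ∧
      ∀ x y, u.vertexMap x = u.vertexMap y ↔ PairRel a b x y ∨ PairRel c d x y) := by
  rw [← τ.card_levels, ← σ.card_levels] at hd
  have hi := τ.levelIncl_injective
  have hlt : ∀ a, (τ.levelIncl a).1 < n := fun a => a.1.2
  refine (exists_ker_of_card_eq_add_two u.levelMap_surjective hd).imp ?_ ?_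
  · rintro ⟨a, b, c, hab, hbc, hac, h⟩
    refine ⟨τ.levelIncl a, τ.levelIncl b, τ.levelIncl c, hi.ne hab, hi.ne hbc, hi.ne hac,
      u.vertexMap_eq_iff (fun x => Or.inl rfl) ?_ fun x y => ?_⟩
    · grind
    · simp [h, hi.eq_iff]
  · rintro ⟨a, b, c, d, hab, hcd, hac, had, hbc, hbd, h⟩
    refine ⟨τ.levelIncl a, τ.levelIncl b, τ.levelIncl c, τ.levelIncl d, hi.ne hab, hi.ne hcd,
      hi.ne hac, hi.ne had, hi.ne hbc, hi.ne hbd,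
      u.vertexMap_eq_iff (fun x => Or.inl (Or.inl rfl)) ?_ fun x y => ?_⟩
    · unfold PairRel; grind
    · simp [h, PairRel, hi.eq_iff]

theorem card_tieBreak (u : PTreeHom τ σ) (hd : τ.deg = σ.deg + 2) :
    Nat.card {T // IsTieBreak τ.parent u.vertexMap T} = 2 := by
  refine _root_.card_tieBreak (fun x y h => ?_) (fun x y h => ?_) (fun x => x.1) (fun x => rfl)
    (fun x y h => level_eq h) (u.exists_ker_of_deg_eq_add_two hd)
  · rw [vertexMap_parent, vertexMap_parent, h]
  · exact τ.le_or_le (Nat.succ_injective (congrArg Sigma.fst h))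

end PTreeHom

/-- The strict part of the total preorder obtained from a tie-breaking rule by comparing
vertices lexicographically, parents first. -/
inductive TieLT {V V' : Type*} [PartialOrder V'] (P : V → V) (U : V → V') (T : V → V → Prop) :
    V → V → Prop
  | parent {x y : V} : TieLT P U T (P x) (P y) → TieLT P U T x y
  | lt {x y : V} : T (P x) (P y) → T (P y) (P x) → U x < U y → TieLT P U T x y
  | tie {x y : V} : T (P x) (P y) → T (P y) (P x) → T x y → ¬ T y x → TieLT P U T x y

/-- The total preorder obtained from a tie-breaking rule. -/
def TieLE {V V' : Type*} [PartialOrder V'] (P : V → V) (U : V → V') (T : V → V → Prop)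
    (x y : V) : Prop :=
  TieLT P U T x y ∨ (T x y ∧ T y x)

section TieLE

variable {V V' : Type*} [PartialOrder V] [PartialOrder V'] {P : V → V} {U : V → V'}
  {T : V → V → Prop}

namespace IsTieBreak

theorem not_rel_of_tieLT (hT : IsTieBreak P U T) {x y : V} (h : TieLT P U T x y) : ¬ T y x := by
  induction h with
  | parent _ ih => exact fun h => ih (hT.parent h)
  | lt _ _ h => exact fun h' => h.ne (hT.ker h').symm
  | tie _ _ _ h => exact h

theorem tieLT_asymm (hT : IsTieBreak P U T) {x y : V} (h : TieLT P U T x y) :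
    ¬ TieLT P U T y x := by
  induction h with
  | parent hp ih =>
    rintro (h | ⟨h1, h2⟩ | ⟨h1, h2⟩)
    · exact ih h
    · exact hT.not_rel_of_tieLT hp h1
    · exact hT.not_rel_of_tieLT hp h1
  | lt h1 h2 h =>
    rintro (h' | ⟨_, _, h'⟩ | ⟨_, _, h'⟩)
    · exact hT.not_rel_of_tieLT h' h1
    · exact h.asymm h'
    · exact h.ne (hT.ker h').symm
  | tie h1 h2 h h3 =>
    rintro (h' | ⟨_, _, h'⟩ | ⟨_, _, h'⟩)
    · exact hT.not_rel_of_tieLT h' h1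
    · exact h'.ne (hT.ker h).symm
    · exact h3 h'

theorem tieLE_antisymm_iff (hT : IsTieBreak P U T) {x y : V} :
    TieLE P U T x y ∧ TieLE P U T y x ↔ T x y ∧ T y x := by
  constructor
  · rintro ⟨h1 | h1, h2 | h2⟩
    · exact absurd h2 (hT.tieLT_asymm h1)
    · exact h2.symm
    · exact h1
    · exact h1
  · exact fun h => ⟨Or.inr h, Or.inr h.symm⟩

theorem tieLE_parent (hT : IsTieBreak P U T) {x y : V} (h : TieLE P U T x y) :
    TieLE P U T (P x) (P y) := by
  rcases h with (h | ⟨h1, h2⟩ | ⟨h1, h2⟩) | h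
  · exact Or.inl h
  · exact Or.inr ⟨h1, h2⟩
  · exact Or.inr ⟨h1, h2⟩
  · exact Or.inr ⟨hT.parent h.1, hT.parent h.2⟩

theorem map_le_of_tieLE (hT : IsTieBreak P U T) {x y : V} (h : TieLE P U T x y)
    (hp : T (P y) (P x)) : U x ≤ U y := by
  rcases h with (h | ⟨_, _, h⟩ | ⟨_, _, h⟩) | h
  · exact absurd hp (hT.not_rel_of_tieLT h)
  · exact h.le
  · exact (hT.ker h).le
  · exact (hT.ker h.1).le

theorem rel_of_tieLE (hT : IsTieBreak P U T) {x y : V} (h : TieLE P U T x y) (hU : U x = U y) :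
    T x y := by
  rcases h with h | h
  · exact (hT.total hU).resolve_right (hT.not_rel_of_tieLT h)
  · exact h.1

end IsTieBreak

end TieLE

namespace IsTieBreak

variable {n : ℕ} {τ θ σ : PTree n} {u : PTreeHom τ σ} {T : τ.Vertex → τ.Vertex → Prop}

theorem tieLT_level {x y : τ.Vertex} (hT : IsTieBreak τ.parent u.vertexMap T)
    (h : TieLT τ.parent u.vertexMap T x y) : x.1 = y.1 := by
  induction h with
  | parent _ ih => exact Nat.succ_injective ih
  | lt h _ _ => exact Nat.succ_injective (PTreeHom.level_eq (hT.ker h))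
  | tie _ _ h _ => exact PTreeHom.level_eq (hT.ker h)

theorem trichotomy (hT : IsTieBreak τ.parent u.vertexMap T) {x y : τ.Vertex} (h : x.1 = y.1) :
    TieLT τ.parent u.vertexMap T x y ∨ (T x y ∧ T y x) ∨ TieLT τ.parent u.vertexMap T y x := by
  suffices H : ∀ k (x y : τ.Vertex), x.1 = y.1 → n ≤ x.1 + k →
      TieLT τ.parent u.vertexMap T x y ∨ (T x y ∧ T y x) ∨ TieLT τ.parent u.vertexMap T y x from
    H n x y h (by omega)
  intro k
  induction k with
  | zero =>
    intro x y h hn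
    obtain rfl := τ.eq_of_le_level h hn
    exact Or.inr (Or.inl ⟨hT.refl x, hT.refl x⟩)
  | succ k ih =>
    intro x y h hn
    rcases ih (τ.parent x) (τ.parent y) (congrArg Nat.succ h)
      (by simp only [PTree.parent]; omega) with hp | ⟨h1, h2⟩ | hp
    · exact Or.inl (.parent hp)
    · by_cases hU : u.vertexMap x = u.vertexMap y
      · by_cases hxy : T x y <;> by_cases hyx : T y x
        · exact Or.inr (Or.inl ⟨hxy, hyx⟩)
        · exact Or.inl (.tie h1 h2 hxy hyx)
        · exact Or.inr (Or.inr (.tie h2 h1 hyx hxy))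
        · exact absurd (hT.total hU) (by tauto)
      · rcases σ.le_or_le (x := u.vertexMap x) (y := u.vertexMap y) h with h' | h'
        · exact Or.inl (.lt h1 h2 (lt_of_le_of_ne h' hU))
        · exact Or.inr (Or.inr (.lt h2 h1 (lt_of_le_of_ne h' (Ne.symm hU))))
    · exact Or.inr (Or.inr (.parent hp))

theorem tieLE_total (hT : IsTieBreak τ.parent u.vertexMap T) {x y : τ.Vertex} (h : x.1 = y.1) :
    TieLE τ.parent u.vertexMap T x y ∨ TieLE τ.parent u.vertexMap T y x := by
  rcases hT.trichotomy h with h | h | h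
  · exact Or.inl (Or.inl h)
  · exact Or.inl (Or.inr h)
  · exact Or.inr (Or.inl h)

theorem tieLE_of_rel (hT : IsTieBreak τ.parent u.vertexMap T) {x y : τ.Vertex} (h : T x y) :
    TieLE τ.parent u.vertexMap T x y := by
  rcases hT.trichotomy (PTreeHom.level_eq (hT.ker h)) with h' | h' | h'
  · exact Or.inl h'
  · exact Or.inr h'
  · exact absurd h (hT.not_rel_of_tieLT h')

theorem tieLE_of_sibling (hT : IsTieBreak τ.parent u.vertexMap T) {x y : τ.Vertex}
    (hp : τ.parent x = τ.parent y) (h : x ≤ y) : TieLE τ.parent u.vertexMap T x y := by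
  rcases (u.vertexMap_le hp h).eq_or_lt with hU | hU
  · exact hT.tieLE_of_rel (hT.sibling hp hU h)
  · exact Or.inl (.lt (hp ▸ hT.refl _) (hp ▸ hT.refl _) hU)

theorem tieLE_trans (hT : IsTieBreak τ.parent u.vertexMap T) {x y z : τ.Vertex}
    (hxy : TieLE τ.parent u.vertexMap T x y) (hyz : TieLE τ.parent u.vertexMap T y z) :
    TieLE τ.parent u.vertexMap T x z := by
  have level : ∀ {x y : τ.Vertex}, TieLE τ.parent u.vertexMap T x y → x.1 = y.1 := fun h =>
    h.elim hT.tieLT_level fun h => PTreeHom.level_eq (hT.ker h.1)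
  suffices H : ∀ k (x y z : τ.Vertex), n ≤ x.1 + k → TieLE τ.parent u.vertexMap T x y →
      TieLE τ.parent u.vertexMap T y z → TieLE τ.parent u.vertexMap T x z from
    H n x y z (by omega) hxy hyz
  intro k
  induction k with
  | zero =>
    intro x y z hn hxy hyz
    obtain rfl := τ.eq_of_le_level (level hxy) hn
    exact hyz
  | succ k ih =>
    intro x y z hn hxy hyz
    have hp := ih _ _ _ (by simp only [PTree.parent]; omega) (hT.tieLE_parent hxy)
      (hT.tieLE_parent hyz)
    rcases hp with hp | ⟨h1, h2⟩
    · exact Or.inl (.parent hp)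
    have hzy : TieLE τ.parent u.vertexMap T (τ.parent z) (τ.parent y) :=
      ih _ _ _ (by rw [← level (hT.tieLE_parent hyz), ← level (hT.tieLE_parent hxy)]
                   simp only [PTree.parent]; omega)
        (Or.inr ⟨h2, h1⟩) (hT.tieLE_parent hxy)
    have e1 := hT.tieLE_antisymm_iff.1 ⟨hT.tieLE_parent hyz, hzy⟩
    have e2 : T (τ.parent y) (τ.parent x) := hT.trans e1.1 h2
    have u1 := hT.map_le_of_tieLE hxy e2
    have u2 := hT.map_le_of_tieLE hyz e1.2
    rcases (u1.trans u2).eq_or_lt with hU | hU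
    · have hU1 : u.vertexMap x = u.vertexMap y := le_antisymm u1 (hU ▸ u2)
      exact hT.tieLE_of_rel (hT.trans (hT.rel_of_tieLE hxy hU1)
        (hT.rel_of_tieLE hyz (hU1 ▸ hU)))
    · exact Or.inl (.lt h1 h2 hU)

end IsTieBreak

theorem exists_surjective_le_iff {a : ℕ} (R : Fin a → Fin a → Prop)
    (total : ∀ x y, R x y ∨ R y x) (trans : ∀ x y z, R x y → R y z → R x z) :
    ∃ (b : ℕ) (f : Fin a → Fin b), Function.Surjective f ∧ ∀ x y, f x ≤ f y ↔ R x y := by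
  classical
  let g : Fin a → ℕ := fun x => (Finset.univ.filter fun y => R y x).card
  have hg : ∀ x y, g x ≤ g y ↔ R x y := by
    intro x y
    constructor
    · intro h
      by_contra hxy
      refine absurd h (not_le.2 (Finset.card_lt_card ?_))
      rw [Finset.ssubset_iff_of_subset]
      · exact ⟨x, by simpa using (total x x).elim id id, by simpa using hxy⟩
      · intro z hz
        simp only [Finset.mem_filter, Finset.mem_univ, true_and] at hz ⊢
        exact trans _ _ _ hz ((total x y).resolve_left hxy)
    · intro h
      refine Finset.card_le_card fun z hz => ?_
      simp only [Finset.mem_filter, Finset.mem_univ, true_and] at hz ⊢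
      exact trans _ _ _ hz h
  let s := Finset.univ.image g
  let e := s.orderIsoOfFin rfl
  refine ⟨s.card, fun x => e.symm ⟨g x, Finset.mem_image_of_mem _ (Finset.mem_univ _)⟩, ?_, ?_⟩
  · intro c
    obtain ⟨x, -, hx⟩ := Finset.mem_image.1 (e c).2
    exact ⟨x, by simp [hx]⟩
  · intro x y
    simp [hg]

theorem eq_and_val_eq_of_le_iff {a b c : ℕ} {f : Fin a → Fin b} {g : Fin a → Fin c}
    (hf : Function.Surjective f) (hg : Function.Surjective g)
    (h : ∀ x y, f x ≤ f y ↔ g x ≤ g y) : b = c ∧ ∀ x, (f x : ℕ) = g x := by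
  have hinj : ∀ x y, f x = f y ↔ g x = g y := fun x y => by
    rw [le_antisymm_iff, le_antisymm_iff, h, h]
  have key : ∀ x, g (Function.surjInv hf (f x)) = g x := fun x =>
    (hinj _ _).1 (Function.surjInv_eq hf _)
  have key' : ∀ x, f (Function.surjInv hg (g x)) = f x := fun x =>
    (hinj _ _).2 (Function.surjInv_eq hg _)
  let e : Fin b ≃o Fin c :=
    { toFun := fun i => g (Function.surjInv hf i)
      invFun := fun i => f (Function.surjInv hg i)
      left_inv := fun i => by simp [key', Function.surjInv_eq hf]
      right_inv := fun i => by simp [key, Function.surjInv_eq hg]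
      map_rel_iff' := by
        intro i j
        simp [← h, Function.surjInv_eq hf] }
  have he : ∀ x, e (f x) = g x := key
  have hbc : b = c := by simpa using Fintype.card_congr e.toEquiv
  refine ⟨hbc, fun x => ?_⟩
  rw [← he, Fin.coe_orderIso_apply]

namespace PTreeHom

variable {n : ℕ} {τ θ σ : PTree n} {u : PTreeHom τ σ} {w : PTreeHom τ θ} {v : PTreeHom θ σ}

/-- The tie-breaking rule determined by a factorization of `u` with first factor `w`. -/
def tieBreak (u : PTreeHom τ σ) (w : PTreeHom τ θ) (x y : τ.Vertex) : Prop :=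
  u.vertexMap x = u.vertexMap y ∧ w.vertexMap x ≤ w.vertexMap y

theorem tieBreak_antisymm_iff (hc : ∀ x, v.vertexMap (w.vertexMap x) = u.vertexMap x)
    {x y : τ.Vertex} :
    (u.tieBreak w x y ∧ u.tieBreak w y x) ↔ w.vertexMap x = w.vertexMap y := by
  constructor
  · rintro ⟨h1, h2⟩
    exact le_antisymm h1.2 h2.2
  · intro h
    have hU : u.vertexMap x = u.vertexMap y := by rw [← hc, ← hc, h]
    exact ⟨⟨hU, h.le⟩, ⟨hU.symm, h.ge⟩⟩

theorem isTieBreak_tieBreak (hc : ∀ x, v.vertexMap (w.vertexMap x) = u.vertexMap x)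
    (hd : τ.deg = θ.deg + 1) : IsTieBreak τ.parent u.vertexMap (u.tieBreak w) where
  ker h := h.1
  total {x y} h := (θ.le_or_le (x := w.vertexMap x) (y := w.vertexMap y)
    (level_eq (u := u) h)).imp (fun h' => ⟨h, h'⟩) (fun h' => ⟨h.symm, h'⟩)
  trans h1 h2 := ⟨h1.1.trans h2.1, h1.2.trans h2.2⟩
  parent h := by
    refine ⟨?_, ?_⟩
    · rw [vertexMap_parent, vertexMap_parent, h.1]
    · rw [vertexMap_parent, vertexMap_parent]
      exact θ.parent_mono h.2
  sibling hp hU h := ⟨hU, w.vertexMap_le hp h⟩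
  merge := by
    obtain ⟨a, b, hab, h⟩ := w.deg_eq_add_one_iff.1 hd
    exact ⟨a, b, hab, fun x y => by rw [tieBreak_antisymm_iff hc, h]⟩

theorem lt_of_tieLT (hc : ∀ x, v.vertexMap (w.vertexMap x) = u.vertexMap x)
    (hT : IsTieBreak τ.parent u.vertexMap (u.tieBreak w)) {x y : τ.Vertex}
    (h : TieLT τ.parent u.vertexMap (u.tieBreak w) x y) : w.vertexMap x < w.vertexMap y := by
  have aux : ∀ {x y : τ.Vertex}, x.1 = y.1 → ¬ w.vertexMap y ≤ w.vertexMap x →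
      w.vertexMap x < w.vertexMap y := fun {x y} hl hn =>
    lt_of_le_not_ge ((θ.le_or_le (x := w.vertexMap x) (y := w.vertexMap y) hl).resolve_right hn) hn
  have hl := hT.tieLT_level h
  induction h with
  | @parent x y hp ih =>
    refine aux hl fun h => ?_
    have := ih (congrArg Nat.succ hl)
    rw [vertexMap_parent, vertexMap_parent] at this
    exact this.not_ge (θ.parent_mono h)
  | @lt x y h1 h2 hU =>
    refine aux hl fun h => hU.not_ge ?_
    rw [← hc, ← hc]
    refine v.vertexMap_le ?_ h
    rw [← vertexMap_parent, ← vertexMap_parent]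
    exact ((tieBreak_antisymm_iff hc).1 ⟨h1, h2⟩).symm
  | tie _ _ h h' => exact aux hl fun hle => h' ⟨h.1.symm, hle⟩

theorem tieLE_iff (hc : ∀ x, v.vertexMap (w.vertexMap x) = u.vertexMap x)
    (hT : IsTieBreak τ.parent u.vertexMap (u.tieBreak w)) {x y : τ.Vertex} :
    TieLE τ.parent u.vertexMap (u.tieBreak w) x y ↔ w.vertexMap x ≤ w.vertexMap y := by
  constructor
  · rintro (h | h)
    · exact (lt_of_tieLT hc hT h).le
    · exact h.1.2
  · intro h
    rcases hT.trichotomy (x := x) (y := y) (θ.level_eq_of_le h :) with h' | h' | h'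
    · exact Or.inl h'
    · exact Or.inr h'
    · exact absurd h (lt_of_tieLT hc hT h').not_ge

end PTreeHom

theorem exists_factorization {n : ℕ} {τ σ : PTree n} {u : PTreeHom τ σ}
    {T : τ.Vertex → τ.Vertex → Prop} (hT : IsTieBreak τ.parent u.vertexMap T) :
    ∃ (θ : PTree n) (w : PTreeHom τ θ) (v : PTreeHom θ σ),
      (∀ i x, v.app i (w.app i x) = u.app i x) ∧
      ∀ i x y, w.app i x ≤ w.app i y ↔ TieLE τ.parent u.vertexMap T ⟨i, x⟩ ⟨i, y⟩ := by
  have H : ∀ i, ∃ (b : ℕ) (f : Fin (τ.t i) → Fin b), Function.Surjective f ∧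
      ∀ x y, f x ≤ f y ↔ TieLE τ.parent u.vertexMap T ⟨i, x⟩ ⟨i, y⟩ := fun i =>
    exists_surjective_le_iff _ (fun x y => hT.tieLE_total rfl) fun x y z => hT.tieLE_trans
  choose b f hf hle using H
  have heq : ∀ i x y, f i x = f i y → T ⟨i, x⟩ ⟨i, y⟩ ∧ T ⟨i, y⟩ ⟨i, x⟩ := fun i x y h =>
    hT.tieLE_antisymm_iff.1 ⟨(hle i x y).1 h.le, (hle i y x).1 h.ge⟩
  let s : ∀ i, Fin (b i) → Fin (τ.t i) := fun i => Function.surjInv (hf i)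
  have hs : ∀ i x, f i (s i x) = x := fun i => Function.surjInv_eq (hf i)
  have hmono : ∀ i x y, f i x ≤ f i y → f (i + 1) (τ.map i x) ≤ f (i + 1) (τ.map i y) :=
    fun i x y h => (hle _ _ _).2 (hT.tieLE_parent ((hle i x y).1 h))
  have hmap : ∀ i x, f (i + 1) (τ.map i (s i (f i x))) = f (i + 1) (τ.map i x) := fun i x =>
    le_antisymm (hmono i _ _ (hs i _).le) (hmono i _ _ (hs i _).ge)
  have hv : ∀ i x, u.app i (s i (f i x)) = u.app i x := fun i x => by
    have := hT.ker (heq i _ _ (hs i (f i x))).1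
    simpa [PTreeHom.vertexMap] using this
  let θ : PTree n :=
    { t := b
      map := fun i c => f (i + 1) (τ.map i (s i c))
      mono := fun i c d h => hmono i _ _ (by rwa [hs, hs])
      surjmap := fun i c => by
        obtain ⟨y, rfl⟩ := hf _ c
        obtain ⟨x, rfl⟩ := τ.surjmap i y
        exact ⟨f i x, hmap i x⟩
      top := fun i hi => by
        have h1 : b i ≤ τ.t i := by simpa using Fintype.card_le_of_surjective _ (hf i)
        have h2 : 0 < b i := (f i ⟨0, by rw [τ.top i hi]; exact one_pos⟩).pos
        have := τ.top i hi
        omega }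
  let w : PTreeHom τ θ :=
    { app := f
      surj := hf
      comm := fun i x => (hmap i x).symm
      fiberMono := fun i x y hp h => (hle i x y).2
        (hT.tieLE_of_sibling (by simp [PTree.parent, hp]) (Sigma.LE.fiber _ _ _ h)) }
  let v : PTreeHom θ σ :=
    { app := fun i c => u.app i (s i c)
      surj := fun i c => by
        obtain ⟨x, rfl⟩ := u.surj i c
        exact ⟨f i x, hv i x⟩
      comm := fun i c => by
        change u.app (i + 1) (s (i + 1) (f (i + 1) (τ.map i (s i c)))) = _
        rw [hv, u.comm]
      fiberMono := fun i c d hp h => by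
        have hTp := (heq (i + 1) _ _ hp).2
        have hcd : f i (s i c) ≤ f i (s i d) := by rwa [hs, hs]
        simpa [PTreeHom.vertexMap] using hT.map_le_of_tieLE ((hle i _ _).1 hcd) hTp }
  exact ⟨θ, w, v, hv, hle⟩

theorem factorization_ext {n : ℕ} {τ σ θ θ' : PTree n} {w : PTreeHom τ θ} {v : PTreeHom θ σ}
    {w' : PTreeHom τ θ'} {v' : PTreeHom θ' σ}
    (hc : ∀ i x, v.app i (w.app i x) = v'.app i (w'.app i x))
    (hle : ∀ i x y, w.app i x ≤ w.app i y ↔ w'.app i x ≤ w'.app i y) :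
    (⟨θ, w, v⟩ : Σ θ : PTree n, (τ ⟶ θ) × (θ ⟶ σ)) = ⟨θ', w', v'⟩ := by
  have H := fun i => eq_and_val_eq_of_le_iff (w.surj i) (w'.surj i) (hle i)
  obtain ⟨t, map, mono, surjmap, top⟩ := θ
  obtain ⟨t', map', mono', surjmap', top'⟩ := θ'
  obtain rfl : t = t' := funext fun i => (H i).1
  obtain ⟨a, ha, ca, fa⟩ := w
  obtain ⟨a', ha', ca', fa'⟩ := w'
  obtain rfl : a = a' := funext fun i => funext fun x => Fin.ext ((H i).2 x)
  obtain rfl : map = map' := by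
    funext i c
    obtain ⟨x, rfl⟩ := ha i c
    exact (ca i x).symm.trans (ca' i x)
  obtain ⟨b, hb, cb, fb⟩ := v
  obtain ⟨b', hb', cb', fb'⟩ := v'
  obtain rfl : b = b' := by
    funext i c
    obtain ⟨x, rfl⟩ := ha i c
    exact hc i x
  rfl

theorem comp_eq_iff {n : ℕ} {τ θ σ : PTree n} (u : PTreeHom τ σ) (w : PTreeHom τ θ)
    (v : PTreeHom θ σ) :
    (show τ ⟶ θ from w) ≫ (show θ ⟶ σ from v) = u ↔
      ∀ i x, v.app i (w.app i x) = u.app i x := by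
  constructor
  · rintro rfl i x
    rfl
  · intro h
    exact PTreeHom.ext' (funext fun i => funext fun x => h i x)

theorem PTreeHom.vertexMap_le_iff {n : ℕ} {τ θ : PTree n} (w : PTreeHom τ θ) (i : ℕ)
    (x y : Fin (τ.t i)) :
    w.vertexMap ⟨i, x⟩ ≤ w.vertexMap ⟨i, y⟩ ↔ w.app i x ≤ w.app i y :=
  Sigma.mk_le_mk_iff

/-- Every morphism of `Ω_n^epi` of degree 2 admits exactly two
factorizations `u = v ∘ w` into composites of two degree-1 morphisms. -/
theorem stmt_4 (n : ℕ) (hn : 1 ≤ n) {τ σ : PTree n} (u : τ ⟶ σ)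
    (h : homDeg u = 2) :
    Nat.card {p : Σ θ : PTree n, (τ ⟶ θ) × (θ ⟶ σ) //
      p.2.1 ≫ p.2.2 = u ∧ homDeg p.2.1 = 1 ∧ homDeg p.2.2 = 1} = 2 := by
  unfold homDeg at h ⊢
  have hcomp : ∀ {θ : PTree n} {w : PTreeHom τ θ} {v : PTreeHom θ σ},
      (∀ i x, v.app i (w.app i x) = PTreeHom.app u i x) →
      ∀ x, v.vertexMap (w.vertexMap x) = PTreeHom.vertexMap u x := fun hc x =>
    Sigma.ext rfl (heq_of_eq (hc x.1 x.2))
  rw [← PTreeHom.card_tieBreak u (by omega)]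
  refine Nat.card_eq_of_bijective
    (fun p => ⟨PTreeHom.tieBreak u p.1.2.1, PTreeHom.isTieBreak_tieBreak (v := p.1.2.2)
      (hcomp ((comp_eq_iff u _ _).1 p.2.1)) (by have := p.2.2.1; omega)⟩) ⟨?_, ?_⟩
  · rintro ⟨⟨θ, w, v⟩, hc, hw, hv⟩ ⟨⟨θ', w', v'⟩, hc', hw', hv'⟩ he
    have he' : PTreeHom.tieBreak u w = PTreeHom.tieBreak u w' := congrArg Subtype.val he
    have hc1 := (comp_eq_iff u _ _).1 hc
    have hc2 := (comp_eq_iff u _ _).1 hc'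
    have hT := PTreeHom.isTieBreak_tieBreak (hcomp hc1) (by simp only at hw; omega)
    have hT' := PTreeHom.isTieBreak_tieBreak (hcomp hc2) (by simp only at hw'; omega)
    refine Subtype.ext (factorization_ext (fun i x => (hc1 i x).trans (hc2 i x).symm) ?_)
    intro i x y
    rw [← PTreeHom.vertexMap_le_iff, ← PTreeHom.vertexMap_le_iff,
      ← PTreeHom.tieLE_iff (hcomp hc1) hT, ← PTreeHom.tieLE_iff (hcomp hc2) hT', he']
  · rintro ⟨T, hT⟩
    obtain ⟨θ, w, v, hc, hle⟩ := exists_factorization hT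
    have hle' : ∀ {x y : τ.Vertex}, x.1 = y.1 →
        (w.vertexMap x ≤ w.vertexMap y ↔
          TieLE τ.parent (PTreeHom.vertexMap u) T x y) := by
      rintro ⟨i, x⟩ ⟨j, y⟩ hij
      obtain rfl : i = j := hij
      rw [PTreeHom.vertexMap_le_iff, hle]
    have hdeg : τ.deg = θ.deg + 1 := by
      rw [w.deg_eq_add_one_iff]
      obtain ⟨a, b, hab, hm⟩ := hT.merge
      refine ⟨a, b, hab, fun x y => ?_⟩
      rw [← hm]
      constructor
      · intro hw
        have hl := PTreeHom.level_eq hw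
        exact hT.tieLE_antisymm_iff.1 ⟨(hle' hl).1 hw.le, (hle' hl.symm).1 hw.ge⟩
      · rintro ⟨h1, h2⟩
        have hl := PTreeHom.level_eq (hT.ker h1)
        exact le_antisymm ((hle' hl).2 (hT.tieLE_of_rel h1))
          ((hle' hl.symm).2 (hT.tieLE_of_rel h2))
    refine ⟨⟨⟨θ, w, v⟩, (comp_eq_iff u w v).2 hc, ?_, ?_⟩, Subtype.ext ?_⟩
    · simp only; omega
    · simp only; omega
    · funext x y
      refine propext ⟨fun ⟨hU, hw⟩ => ?_, fun hxy => ⟨hT.ker hxy, ?_⟩⟩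
      · exact hT.rel_of_tieLE ((hle' (PTreeHom.level_eq hU)).1 hw) hU
      · exact (hle' (PTreeHom.level_eq (hT.ker hxy))).2 (hT.tieLE_of_rel hxy)
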